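/- Let d ≥ 3, s ≤ r, and let 𝒮 = K[x_1,…,x_s] ⊆ ℛ with dual ring S = K[∂_1,…,∂_s]. Suppose h ∈ 𝒮_d admits no regular splitting of length ≥ 2, and set f = h + x_{s+1}^d/d! + … + x_r^d/d! ∈ ℛ_d. Assume there exists f_t ∈ ℛ_d ⊗_K K[t_1,…,t_n] with f_0 = f (evaluation at t_1 = … = t_n = 0) such that f_t splits regularly m−1 times over K(t_1,…,t_n), and suppose m > r − s + 1. Then M_h ⊆ Mat_s(K) (computed with respect to S acting on 𝒮) contains a nonzero nilpotent matrix of rank ≤ s/(m−r+s), i.e., a nonzero nilpotent B ∈ M_h with (m−r+s)·rank(B) ≤ s. -/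

import Mathlib

open MvPolynomial

namespace Kleppe

noncomputable section

open scoped Classical

variable {K : Type*}

/-- The iterated partial-derivative operator `∂^β` applied to `f`
(in the standard polynomial ring; char 0 identification of divided powers). -/
def derivMulti [CommSemiring K] {r : ℕ} (β : Fin r →₀ ℕ) (f : MvPolynomial (Fin r) K) :
    MvPolynomial (Fin r) K :=
  ∑ α ∈ f.support,
    if β ≤ α then
      MvPolynomial.monomial (α - β)
        ((∏ i : Fin r, (α i).descFactorial (β i)) • MvPolynomial.coeff α f)
    else 0

/-- The apolarity action `D(f)` of a differential operator `D ∈ R = K[∂_1,…,∂_r]`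
on a polynomial `f ∈ ℛ = K[x_1,…,x_r]`; `∂_i` acts as `∂/∂x_i`. -/
def contract [CommSemiring K] {r : ℕ} (D f : MvPolynomial (Fin r) K) :
    MvPolynomial (Fin r) K :=
  ∑ β ∈ D.support, MvPolynomial.coeff β D • derivMulti β f

/-- `(A∂)_i = Σ_k A_{ik} ∂_k`, as an element of `R`. -/
def rowOp [CommSemiring K] {r : ℕ} (A : Matrix (Fin r) (Fin r) K) (i : Fin r) :
    MvPolynomial (Fin r) K :=
  ∑ k : Fin r, A i k • X k

/-- The matrix space `M_f = {A | ∂_i·(A∂)_j − ∂_j·(A∂)_i ∈ ann_R f for all i,j}`. -/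
def Mf [CommRing K] {r : ℕ} (f : MvPolynomial (Fin r) K) :
    Set (Matrix (Fin r) (Fin r) K) :=
  {A | ∀ i j : Fin r, contract (X i * rowOp A j - X j * rowOp A i) f = 0}

/-- `γ_f(A)`: the unique homogeneous `g` of degree `d` with `∂_i g = (A∂)_i (f)` for all `i`
(defined by choice; junk value `0` if no such `g` exists). -/
def gammaf [CommRing K] {r : ℕ} (d : ℕ) (f : MvPolynomial (Fin r) K)
    (A : Matrix (Fin r) (Fin r) K) : MvPolynomial (Fin r) K :=
  if h : ∃ g : MvPolynomial (Fin r) K, g.IsHomogeneous d ∧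
      ∀ i, contract (X i) g = contract (rowOp A i) f then h.choose else 0

/-- `R_e(g)`, the space of contractions of `g` by homogeneous operators of degree `e`. -/
def partials [CommRing K] {r : ℕ} (e : ℕ) (g : MvPolynomial (Fin r) K) :
    Submodule K (MvPolynomial (Fin r) K) :=
  Submodule.span K {p | ∃ D : MvPolynomial (Fin r) K, D.IsHomogeneous e ∧ p = contract D g}

/-- `G` is (the set of components of) a regular splitting of `f`:
`f = Σ_{g ∈ G} g`, each `g` a nonzero degree-`d` form, and the spaces of
`(d−1)`-st partials `R_{d−1}(g)` are independent. -/
def IsRegSplit [CommRing K] {r : ℕ} (d : ℕ) (f : MvPolynomial (Fin r) K)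
    (G : Set (MvPolynomial (Fin r) K)) : Prop :=
  G.Finite ∧ G.Nonempty ∧ (∀ g ∈ G, g ≠ 0 ∧ g.IsHomogeneous d) ∧ (∑ᶠ g ∈ G, g) = f ∧
  ∀ g ∈ G, Disjoint (partials (d - 1) g) (⨆ h ∈ G \ {g}, partials (d - 1) h)

/-- A complete set of orthogonal idempotents in `M_f`. -/
def IsCoid [CommRing K] {r : ℕ} (f : MvPolynomial (Fin r) K)
    (E : Set (Matrix (Fin r) (Fin r) K)) : Prop :=
  E.Finite ∧ E ⊆ Mf f ∧ (∀ A ∈ E, A ≠ 0) ∧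
  (∀ A ∈ E, ∀ B ∈ E, A ≠ B → A * B = 0) ∧ (∑ᶠ A ∈ E, A) = 1

end
set_option linter.unusedSectionVars false

open Finsupp in
/-- divided-power coefficients -/
noncomputable def cc {R : Type*} [CommSemiring R] {r : ℕ} (g : MvPolynomial (Fin r) R)
    (α : Fin r →₀ ℕ) : R :=
  (∏ i, ((α i).factorial : R)) * coeff α g

/-- directional derivative in terms of divided power coefficients -/
noncomputable def dv {R : Type*} [CommSemiring R] {r : ℕ} (c : (Fin r →₀ ℕ) → R)
    (v : Fin r → R) (β : Fin r →₀ ℕ) : R :=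
  ∑ k, v k * c (β + Finsupp.single k 1)

/-- symmetric matrices w.r.t. c -/
def SymM {R : Type*} [CommSemiring R] {r : ℕ} (c : (Fin r →₀ ℕ) → R)
    (A : Matrix (Fin r) (Fin r) R) : Prop :=
  ∀ i j α, dv c (A j) (α + Finsupp.single i 1) = dv c (A i) (α + Finsupp.single j 1)

/-- nondegeneracy -/
def Nondeg {R : Type*} [CommSemiring R] {r : ℕ} (c : (Fin r →₀ ℕ) → R) : Prop :=
  ∀ v, (∀ β, dv c v β = 0) → v = 0

section basics
variable {R : Type*} [CommRing R] {r : ℕ}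

lemma cc_add (f g : MvPolynomial (Fin r) R) (α) : cc (f + g) α = cc f α + cc g α := by
  simp [cc, mul_add]

lemma cc_zero (α) : cc (0 : MvPolynomial (Fin r) R) α = 0 := by
  simp [cc]

lemma cc_sum {ι : Type*} (s : Finset ι) (f : ι → MvPolynomial (Fin r) R) (α) :
    cc (∑ i ∈ s, f i) α = ∑ i ∈ s, cc (f i) α := by
  simp [cc, coeff_sum, Finset.mul_sum]

lemma cc_map {S : Type*} [CommRing S] (φ : R →+* S) (f : MvPolynomial (Fin r) R) (α) :
    cc (map φ f) α = φ (cc f α) := by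
  simp [cc, coeff_map, map_mul, map_prod]

lemma coeff_derivMulti (β α : Fin r →₀ ℕ) (f : MvPolynomial (Fin r) R) :
    coeff α (derivMulti β f) =
      (∏ i, (((α + β) i).descFactorial (β i) : R)) * coeff (α + β) f := by
  classical
  unfold derivMulti
  rw [coeff_sum, Finset.sum_eq_single (α + β)]
  · simp [coeff_monomial]
  · intro γ _ hγ
    split_ifs with hle
    · rw [coeff_monomial, if_neg]
      rintro rfl
      exact hγ (tsub_add_cancel_of_le hle).symm
    · simp
  · intro hns
    have : coeff (α + β) f = 0 := by simpa [mem_support_iff] using hns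
    simp [this]

lemma cc_derivMulti (β α : Fin r →₀ ℕ) (f : MvPolynomial (Fin r) R) :
    cc (derivMulti β f) α = cc f (α + β) := by
  unfold cc
  rw [coeff_derivMulti, ← mul_assoc, ← Finset.prod_mul_distrib]
  congr 1
  refine Finset.prod_congr rfl fun i _ => ?_
  have := Nat.factorial_mul_descFactorial (n := (α + β) i) (k := β i) (by simp)
  rw [← this]
  simp

lemma cc_contract (D f : MvPolynomial (Fin r) R) (α : Fin r →₀ ℕ) :
    cc (contract D f) α = ∑ β ∈ D.support, coeff β D * cc f (α + β) := by
  unfold contract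
  rw [cc_sum]
  refine Finset.sum_congr rfl fun β _ => ?_
  rw [← cc_derivMulti]
  simp [cc]; ring

/-- linear functional evaluating contraction coefficients -/
noncomputable def evc (f : MvPolynomial (Fin r) R) (α : Fin r →₀ ℕ) :
    MvPolynomial (Fin r) R →ₗ[R] R :=
  (MvPolynomial.basisMonomials (Fin r) R).constr R (fun β => cc f (α + β))

lemma cc_contract_eq (D f : MvPolynomial (Fin r) R) (α : Fin r →₀ ℕ) :
    cc (contract D f) α = evc f α D := by
  rw [cc_contract]
  conv_rhs => rw [D.as_sum, map_sum]
  refine Finset.sum_congr rfl fun β _ => ?_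
  have : monomial β (coeff β D) = coeff β D • MvPolynomial.basisMonomials (Fin r) R β := by
    simp [smul_monomial]
  rw [this, map_smul, evc, Module.Basis.constr_basis]
  simp

lemma evc_monomial (f : MvPolynomial (Fin r) R) (α β) (a : R) :
    evc f α (monomial β a) = a * cc f (α + β) := by
  have : monomial β a = a • MvPolynomial.basisMonomials (Fin r) R β := by
    simp [smul_monomial]
  rw [this, map_smul, evc, Module.Basis.constr_basis]
  simp

lemma evc_X_mul_rowOp (f : MvPolynomial (Fin r) R) (α) (A : Matrix (Fin r) (Fin r) R) (i j) :
    evc f α (X i * rowOp A j) = dv (cc f) (A j) (α + Finsupp.single i 1) := by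
  unfold rowOp dv
  rw [Finset.mul_sum, map_sum]
  refine Finset.sum_congr rfl fun k _ => ?_
  have : (X i * (A j k • X k) : MvPolynomial (Fin r) R)
      = monomial (Finsupp.single i 1 + Finsupp.single k 1) (A j k) := by
    rw [mul_smul_comm, X, X, monomial_mul, smul_monomial]; simp
  rw [this, evc_monomial, add_assoc]

end basics

section dom
variable {R : Type*} [CommRing R] [IsDomain R] [CharZero R] {r : ℕ}

lemma cc_eq_zero_iff (f : MvPolynomial (Fin r) R) (α) : cc f α = 0 ↔ coeff α f = 0 := by
  unfold cc
  rw [mul_eq_zero, or_iff_right]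
  rw [Finset.prod_eq_zero_iff]
  push Not
  intro i _
  exact_mod_cast Nat.factorial_ne_zero _

lemma ext_cc {f g : MvPolynomial (Fin r) R} (H : ∀ α, cc f α = cc g α) : f = g := by
  rw [← sub_eq_zero]
  ext α
  rw [coeff_zero, ← cc_eq_zero_iff]
  have := cc_add (f - g) g α
  rw [sub_add_cancel, H] at this
  simpa using this.symm

lemma mem_Mf_iff (f : MvPolynomial (Fin r) R) (A : Matrix (Fin r) (Fin r) R) :
    A ∈ Mf f ↔ SymM (cc f) A := by
  have key : ∀ i j α, cc (contract (X i * rowOp A j - X j * rowOp A i) f) α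
      = dv (cc f) (A j) (α + Finsupp.single i 1) - dv (cc f) (A i) (α + Finsupp.single j 1) := by
    intro i j α
    rw [cc_contract_eq, map_sub, evc_X_mul_rowOp, evc_X_mul_rowOp]
  constructor
  · intro hA i j α
    have := key i j α
    rw [hA i j, cc_zero] at this
    exact (sub_eq_zero.mp this.symm)
  · intro hA i j
    refine ext_cc fun α => ?_
    rw [key, cc_zero, hA i j α, sub_self]

lemma cc_of_degree_ne {f : MvPolynomial (Fin r) R} {d : ℕ} (hf : f.IsHomogeneous d)
    {α : Fin r →₀ ℕ} (hα : α.degree ≠ d) : cc f α = 0 := by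
  rw [cc_eq_zero_iff]
  exact hf.coeff_eq_zero hα

lemma isHomogeneous_of_cc {f : MvPolynomial (Fin r) R} {d : ℕ}
    (H : ∀ α : Fin r →₀ ℕ, α.degree ≠ d → cc f α = 0) : f.IsHomogeneous d := by
  intro α hα
  by_contra hne
  apply hα
  rw [← cc_eq_zero_iff]
  apply H
  intro hd; apply hne; rw [← hd, Finsupp.degree_eq_weight_one]; rfl

lemma cc_single (f : MvPolynomial (Fin r) R) (k) :
    cc f (Finsupp.single k 1) = coeff (Finsupp.single k 1) f := by
  unfold cc
  rw [Finset.prod_eq_one, one_mul]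
  intro i _
  rw [Finsupp.single_apply]
  split_ifs <;> simp

lemma exists_single_of_degree_one {α : Fin r →₀ ℕ} (h : α.degree = 1) :
    ∃ k, α = Finsupp.single k 1 := by
  have h0 : α ≠ 0 := by rintro rfl; simp at h
  obtain ⟨k, hk⟩ := Finsupp.ne_iff.mp h0
  refine ⟨k, ?_⟩
  have hle : Finsupp.single k 1 ≤ α := by
    rw [Finsupp.single_le_iff]
    exact Nat.one_le_iff_ne_zero.mpr hk
  obtain ⟨γ, rfl⟩ := exists_add_of_le hle
  have : γ.degree = 0 := by
    rw [map_add, Finsupp.degree_single] at h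
    omega
  rw [(Finsupp.degree_eq_zero_iff γ).mp this, add_zero]

lemma linear_form {w : MvPolynomial (Fin r) R} (hw : w.IsHomogeneous 1) :
    w = ∑ k, cc w (Finsupp.single k 1) • X k := by
  refine ext_cc fun α => ?_
  by_cases h : α.degree = 1
  · obtain ⟨k, rfl⟩ := exists_single_of_degree_one h
    rw [cc_sum, Finset.sum_eq_single k]
    · simp [cc_single]
    · intro j _ hj
      rw [cc_single]; simp [coeff_X, hj, Finsupp.single_left_inj]
    · simp
  · rw [cc_of_degree_ne hw h, cc_sum, Finset.sum_eq_zero]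
    intro k _
    refine cc_of_degree_ne (d := 1) ?_ h
    rw [smul_eq_C_mul]
    simpa using (isHomogeneous_C (Fin r) (cc w (Finsupp.single k 1))).mul (isHomogeneous_X R k)

lemma cc_pderiv (f : MvPolynomial (Fin r) R) (i) (α) :
    cc (pderiv i f) α = cc f (α + Finsupp.single i 1) := by
  unfold cc
  rw [coeff_pderiv]
  have : (∏ j : Fin r, (((α + Finsupp.single i 1 : Fin r →₀ ℕ) j).factorial : R))
      = (∏ j, ((α j).factorial : R)) * (α i + 1) := by
    rw [← Finset.mul_prod_erase _ _ (Finset.mem_univ i),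
      ← Finset.mul_prod_erase _ (fun j => ((α j).factorial : R)) (Finset.mem_univ i)]
    have h1 : ∏ x ∈ Finset.univ.erase i, (((α + Finsupp.single i 1 : Fin r →₀ ℕ) x).factorial : R)
      = ∏ x ∈ Finset.univ.erase i, ((α x).factorial : R) := by
      refine Finset.prod_congr rfl fun x hx => ?_
      rw [Finset.mem_erase] at hx
      simp [hx.1.symm]
    rw [h1]
    simp [Nat.factorial_succ]
    ring
  rw [this]; ring

end dom

section dvlemmas
variable {R : Type*} [CommRing R] {r : ℕ}

lemma dv_sum_left {ι : Type*} (s : Finset ι) (c : (Fin r →₀ ℕ) → R) (v : ι → Fin r → R) (β) :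
    dv c (∑ i ∈ s, v i) β = ∑ i ∈ s, dv c (v i) β := by
  simp only [dv, Finset.sum_apply, Finset.sum_mul]
  exact Finset.sum_comm

lemma dv_smul (c : (Fin r →₀ ℕ) → R) (a : R) (v : Fin r → R) (β) :
    dv c (a • v) β = a * dv c v β := by
  simp [dv, Finset.mul_sum, mul_assoc]

lemma dv_sub (c : (Fin r →₀ ℕ) → R) (u v : Fin r → R) (β) :
    dv c (u - v) β = dv c u β - dv c v β := by
  simp [dv, sub_mul]

lemma dv_mul (c : (Fin r →₀ ℕ) → R) (A B : Matrix (Fin r) (Fin r) R) (i) (β) :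
    dv c ((A * B) i) β = ∑ k, A i k * dv c (B k) β := by
  have : (A * B) i = ∑ k, A i k • B k := by
    ext j; simp [Matrix.mul_apply]
  rw [this, dv_sum_left]
  simp [dv_smul]

lemma dv_single (c : (Fin r →₀ ℕ) → R) (i) (β) :
    dv c (Pi.single i 1) β = c (β + Finsupp.single i 1) := by
  simp [dv, Pi.single_apply]

lemma dv_one (c : (Fin r →₀ ℕ) → R) (i) (β) :
    dv c ((1 : Matrix (Fin r) (Fin r) R) i) β = c (β + Finsupp.single i 1) := by
  simp [dv, Matrix.one_apply]

lemma dv_map {S : Type*} [CommRing S] (φ : R →+* S) (c : (Fin r →₀ ℕ) → R) (v : Fin r → R) (β) :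
    dv (fun α => φ (c α)) (fun k => φ (v k)) β = φ (dv c v β) := by
  simp [dv, map_sum, map_mul]

lemma SymM.map {S : Type*} [CommRing S] (φ : R →+* S) {c : (Fin r →₀ ℕ) → R}
    {A : Matrix (Fin r) (Fin r) R} (hA : SymM c A) : SymM (fun α => φ (c α)) (A.map φ) := by
  intro i j α
  have := congrArg φ (hA i j α)
  rw [← dv_map, ← dv_map] at this
  exact this

lemma SymM.of_map {S : Type*} [CommRing S] (φ : R →+* S) (hφ : Function.Injective φ)
    {c : (Fin r →₀ ℕ) → R}
    {A : Matrix (Fin r) (Fin r) R} (hA : SymM (fun α => φ (c α)) (A.map φ)) : SymM c A := by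
  intro i j α
  apply hφ
  rw [← dv_map, ← dv_map]
  exact hA i j α

lemma SymM.smul {c : (Fin r →₀ ℕ) → R} (a : R)
    {A : Matrix (Fin r) (Fin r) R} (hA : SymM c A) : SymM c (a • A) := by
  intro i j α
  change dv c (a • A j) _ = dv c (a • A i) _
  rw [dv_smul, dv_smul, hA i j α]

lemma SymM.of_smul [IsDomain R] {c : (Fin r →₀ ℕ) → R} {a : R} (ha : a ≠ 0)
    {A : Matrix (Fin r) (Fin r) R} (hA : SymM c (a • A)) : SymM c A := by
  intro i j α
  have : dv c (a • A j) _ = dv c (a • A i) _ := hA i j α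
  rw [dv_smul, dv_smul] at this
  exact mul_left_cancel₀ ha this

lemma SymM.sum {c : (Fin r →₀ ℕ) → R} {ι : Type*} (s : Finset ι)
    {A : ι → Matrix (Fin r) (Fin r) R} (hA : ∀ i ∈ s, SymM c (A i)) : SymM c (∑ i ∈ s, A i) := by
  intro i j α
  have h : ∀ j, (∑ i ∈ s, A i) j = ∑ i ∈ s, A i j := by
    intro j; ext k; simp [Matrix.sum_apply]
  rw [h, h, dv_sum_left, dv_sum_left]
  exact Finset.sum_congr rfl fun x hx => hA x hx i j α

lemma SymM.one_sub {c : (Fin r →₀ ℕ) → R}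
    {A : Matrix (Fin r) (Fin r) R} (hA : SymM c A) : SymM c (1 - A) := by
  intro i j α
  have h : ∀ j, (1 - A) j = (1 : Matrix (Fin r) (Fin r) R) j - A j := fun j => rfl
  rw [h, h, dv_sub, dv_sub, dv_one, dv_one, hA i j α, add_right_comm]

end dvlemmas

section splitting
variable {L : Type*} [Field L] [CharZero L] {r d : ℕ}

lemma split_vec {f : MvPolynomial (Fin r) L} {G} (hd : 1 ≤ d) (hG : IsRegSplit d f G)
    {g} (hg : g ∈ G) (v : Fin r → L) :
    ∃ v' : Fin r → L, (∀ β, dv (cc g) v' β = dv (cc g) v β) ∧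
      ∀ h ∈ G, h ≠ g → ∀ β, dv (cc h) v' β = 0 := by
  obtain ⟨hfin, hne, hhom, hsum, hdis⟩ := hG
  set W := partials (d - 1) g with hW
  set W' := ⨆ h ∈ G \ {g}, partials (d - 1) h with hW'
  have hWW : W ⊓ W' = ⊥ := (hdis g hg).eq_bot
  have htop := Subspace.dualAnnihilator_inf_eq W W'
  rw [hWW, Submodule.dualAnnihilator_bot] at htop
  -- the functional given by v
  let lam : Module.Dual L (MvPolynomial (Fin r) L) :=
    ∑ k, v k • (MvPolynomial.lcoeff L (Finsupp.single k 1))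
  have hlam : lam ∈ W.dualAnnihilator ⊔ W'.dualAnnihilator := by rw [← htop]; trivial
  obtain ⟨a, ha, b, hb, hab⟩ := Submodule.mem_sup.mp hlam
  rw [Submodule.mem_dualAnnihilator] at ha hb
  have hhom1 : ∀ h ∈ G, ∀ β : Fin r →₀ ℕ, β.degree = d - 1 →
      (contract (monomial β 1) h).IsHomogeneous 1 := by
    intro h hh β hβ
    refine isHomogeneous_of_cc fun α hα => ?_
    rw [cc_contract_eq, evc_monomial, one_mul]
    refine cc_of_degree_ne (hhom h hh).2 ?_
    rw [map_add, hβ]; omega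
  have hmem : ∀ h : MvPolynomial (Fin r) L, ∀ β : Fin r →₀ ℕ, β.degree = d - 1 →
      contract (monomial β 1) h ∈ partials (d - 1) h := by
    intro h β hβ
    apply Submodule.subset_span
    exact ⟨_, isHomogeneous_monomial _ (by simpa [Finsupp.degree_eq_weight_one] using hβ), rfl⟩
  have hbv : ∀ h ∈ G, ∀ β : Fin r →₀ ℕ, β.degree = d - 1 →
      b (contract (monomial β 1) h) = dv (cc h) (fun k => b (X k)) β := by
    intro h hh β hβ
    rw [linear_form (hhom1 h hh β hβ), map_sum, dv]
    refine Finset.sum_congr rfl fun k _ => ?_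
    rw [map_smul, cc_contract_eq, evc_monomial, one_mul, smul_eq_mul, mul_comm, add_comm]
  have hlv : ∀ h : MvPolynomial (Fin r) L, ∀ β : Fin r →₀ ℕ, 
      lam (contract (monomial β 1) h) = dv (cc h) v β := by
    intro h β
    simp only [lam, dv, LinearMap.sum_apply, LinearMap.smul_apply, lcoeff_apply, ← cc_single]
    refine Finset.sum_congr rfl fun k _ => ?_
    rw [cc_contract_eq, evc_monomial, one_mul, smul_eq_mul, add_comm]
  have hdeg : ∀ h ∈ G, ∀ u, ∀ β : Fin r →₀ ℕ, β.degree ≠ d - 1 → dv (cc h) u β = 0 := by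
    intro h hh u β hβ
    refine Finset.sum_eq_zero fun k _ => ?_
    rw [cc_of_degree_ne (hhom h hh).2, mul_zero]
    rw [map_add, Finsupp.degree_single]; omega
  refine ⟨fun k => b (X k), fun β => ?_, fun h hh hhg β => ?_⟩
  · by_cases hβ : β.degree = d - 1
    · rw [← hbv g hg β hβ, ← hlv, ← hab, LinearMap.add_apply, ha _ (hmem g β hβ), zero_add]
    · rw [hdeg g hg _ β hβ, hdeg g hg _ β hβ]
  · by_cases hβ : β.degree = d - 1
    · rw [← hbv h hh β hβ]
      apply hb
      exact (le_iSup₂_of_le (f := fun h (_ : h ∈ G \ {g}) => partials (d - 1) h) h ⟨hh, hhg⟩ le_rfl)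
        (hmem h β hβ)
    · exact hdeg h hh _ β hβ

lemma split_sum {f : MvPolynomial (Fin r) L} {G} (hG : IsRegSplit d f G) [Fintype G] (α) :
    cc f α = ∑ g : G, cc (g : MvPolynomial (Fin r) L) α := by
  rw [← hG.2.2.2.1, ← finsum_set_coe_eq_finsum_mem, finsum_eq_sum_of_fintype, cc_sum]

lemma exists_deriv_ne (hd : 1 ≤ d) {g : MvPolynomial (Fin r) L} (hg : g.IsHomogeneous d)
    (h0 : g ≠ 0) : ∃ i β, cc g (β + Finsupp.single i 1) ≠ 0 := by
  by_contra hcon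
  push Not at hcon
  apply h0
  refine ext_cc fun α => ?_
  rw [cc_zero]
  by_cases hα : α = 0
  · subst hα
    apply cc_of_degree_ne hg
    simp; omega
  · obtain ⟨i, hi⟩ := Finsupp.ne_iff.mp hα
    have hle : Finsupp.single i 1 ≤ α := by
      rw [Finsupp.single_le_iff]
      exact Nat.one_le_iff_ne_zero.mpr hi
    rw [← tsub_add_cancel_of_le hle]
    exact hcon _ _

lemma split_card_le (hd : 1 ≤ d) {f : MvPolynomial (Fin r) L} {G} (hG : IsRegSplit d f G) :
    G.ncard ≤ r := by
  classical
  have : Fintype G := hG.1.fintype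
  have H : ∀ g : G, ∃ v : Fin r → L, (∃ β, dv (cc g.1) v β ≠ 0) ∧
      ∀ h : G, h ≠ g → ∀ β, dv (cc h.1) v β = 0 := by
    intro g
    obtain ⟨i, β, hi⟩ := exists_deriv_ne hd (hG.2.2.1 g g.2).2 (hG.2.2.1 g g.2).1
    obtain ⟨v', h1, h2⟩ := split_vec hd hG g.2 (Pi.single i 1)
    refine ⟨v', ⟨β, ?_⟩, fun h hh β => h2 h h.2 (fun e => hh (Subtype.ext e)) β⟩
    rw [h1, dv_single]; exact hi
  choose v hv1 hv2 using H
  have hli : LinearIndependent L v := by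
    rw [Fintype.linearIndependent_iff]
    intro a ha g
    obtain ⟨β, hβ⟩ := hv1 g
    have := dv_sum_left Finset.univ (cc g.1) (fun i => a i • v i) β
    rw [ha, Finset.sum_eq_single g] at this
    · rw [dv_smul] at this
      have h0 : dv (cc g.1) 0 β = 0 := by simp [dv]
      rw [h0] at this
      exact (mul_eq_zero.mp this.symm).resolve_right hβ
    · intro h _ hh
      rw [dv_smul, hv2 h g hh.symm, mul_zero]
    · simp
  have := hli.fintype_card_le_finrank
  rwa [Module.finrank_fin_fun, ← Nat.card_eq_fintype_card, Nat.card_coe_set_eq] at this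

lemma exists_idem (hd : 1 ≤ d) {f : MvPolynomial (Fin r) L} {G} (hG : IsRegSplit d f G)
    (hnd : Nondeg (cc f)) [Fintype G] :
    ∃ E : G → Matrix (Fin r) (Fin r) L, (∀ g, SymM (cc f) (E g)) ∧
      (∀ g, E g * E g = E g) ∧ (∀ g h, g ≠ h → E g * E h = 0) ∧
      ∑ g, E g = 1 ∧ ∀ g, E g ≠ 0 := by
  have H : ∀ (g : G) (i : Fin r), ∃ v' : Fin r → L,
      (∀ β, dv (cc g.1) v' β = cc g.1 (β + Finsupp.single i 1)) ∧
      ∀ h : G, h ≠ g → ∀ β, dv (cc h.1) v' β = 0 := by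
    intro g i
    obtain ⟨v', h1, h2⟩ := split_vec hd hG g.2 (Pi.single i 1)
    refine ⟨v', fun β => ?_, fun h hh β => h2 h h.2 (fun e => hh (Subtype.ext e)) β⟩
    rw [h1, dv_single]
  choose E0 hE01 hE02 using H
  obtain ⟨E, hE1, hE2⟩ : ∃ E : G → Matrix (Fin r) (Fin r) L,
      (∀ g i β, dv (cc g.1) (E g i) β = cc g.1 (β + Finsupp.single i 1)) ∧
      ∀ (g : G) i (h : G), h ≠ g → ∀ β, dv (cc h.1) (E g i) β = 0 := ⟨E0, hE01, hE02⟩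
  have hfE : ∀ g i β, dv (cc f) (E g i) β = cc g.1 (β + Finsupp.single i 1) := by
    intro g i β
    have : dv (cc f) (E g i) β = ∑ h : G, dv (cc h.1) (E g i) β := by
      unfold dv
      rw [Finset.sum_comm]
      refine Finset.sum_congr rfl fun k _ => ?_
      rw [split_sum hG, Finset.mul_sum]
    rw [this, Finset.sum_eq_single g, hE1]
    · intro h _ hh
      exact hE2 g i h hh β
    · simp
  have hext : ∀ A B : Matrix (Fin r) (Fin r) L,
      (∀ i β, dv (cc f) (A i) β = dv (cc f) (B i) β) → A = B := by
    intro A B hAB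
    funext i
    rw [← sub_eq_zero]
    apply hnd
    intro β
    rw [dv_sub, hAB, sub_self]
  refine ⟨E, ?_, ?_, ?_, ?_, ?_⟩
  · intro g i j α
    rw [hfE, hfE, add_right_comm]
  · intro g
    apply hext
    intro i β
    rw [dv_mul, hfE, ← hE1]
    unfold dv
    exact Finset.sum_congr rfl fun k _ => by rw [← hfE]; rfl
  · intro g h hgh
    apply hext
    intro i β
    rw [dv_mul]
    trans dv (cc h.1) (E g i) β
    · unfold dv
      exact Finset.sum_congr rfl fun k _ => by rw [← hfE]; rfl
    · rw [hE2 g i h hgh.symm]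
      symm
      exact Finset.sum_eq_zero fun k _ => by simp
  · apply hext
    intro i β
    have : (∑ g, (E g : Matrix (Fin r) (Fin r) L)) i = ∑ g, E g i := by
      ext k; simp [Matrix.sum_apply]
    rw [this, dv_sum_left, dv_one, split_sum hG]
    exact Finset.sum_congr rfl fun g _ => hfE g i β
  · intro g h0
    obtain ⟨i, β, hi⟩ := exists_deriv_ne hd (hG.2.2.1 g g.2).2 (hG.2.2.1 g g.2).1
    apply hi
    rw [← hfE, h0]
    exact Finset.sum_eq_zero fun k _ => by simp

end splitting

section power
open PowerSeries
variable {K : Type*} [Field K] [CharZero K]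

lemma exists_line {n : ℕ} (D : MvPolynomial (Fin n) K) (hD : D ≠ 0) :
    ∃ φ : MvPolynomial (Fin n) K →+* PowerSeries K, φ D ≠ 0 ∧
      ∀ p, PowerSeries.constantCoeff (φ p) = MvPolynomial.eval (0 : Fin n → K) p := by
  obtain ⟨a, ha⟩ : ∃ a : Fin n → K, MvPolynomial.eval a D ≠ 0 := by
    by_contra hcon
    push Not at hcon
    exact hD (MvPolynomial.funext (fun x => by simp [hcon x]))
  let ψ : MvPolynomial (Fin n) K →+* Polynomial K :=
    MvPolynomial.eval₂Hom Polynomial.C (fun i => Polynomial.C (a i) * Polynomial.X)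
  have h1 : ∀ (x : K) p, Polynomial.eval x (ψ p) = MvPolynomial.eval (fun i => a i * x) p := by
    intro x p
    have : (Polynomial.evalRingHom x).comp ψ = MvPolynomial.eval (fun i => a i * x) := by
      ext i <;> simp [ψ]
    exact congrArg (fun f => f p) this
  refine ⟨(Polynomial.coeToPowerSeries.ringHom).comp ψ, ?_, ?_⟩
  · intro h0
    have : ψ D = 0 := by
      apply Polynomial.coe_injective K
      simpa using h0
    have h2 := h1 1 D
    rw [this] at h2
    simp at h2
    exact ha h2.symm
  · intro p
    have h2 := h1 0 p
    rw [← Polynomial.coeff_zero_eq_eval_zero] at h2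
    simp only [mul_zero] at h2
    simp only [RingHom.comp_apply, Polynomial.coeToPowerSeries.ringHom_apply,
      Polynomial.constantCoeff_coe]
    exact h2

lemma factor_X {ι : Type*} (w : ι → PowerSeries K) (hw : w ≠ 0) :
    ∃ (a : ℕ) (u : ι → PowerSeries K), (∀ i, w i = PowerSeries.X ^ a * u i) ∧
      ∃ i, PowerSeries.constantCoeff (u i) ≠ 0 := by
  obtain ⟨i0, hi0⟩ := Function.ne_iff.mp hw
  obtain ⟨n, hn⟩ : ∃ n, coeff n (w i0) ≠ 0 := by
    by_contra hcon
    push Not at hcon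
    exact hi0 (PowerSeries.ext (fun n => by simp [hcon n]))
  clear hw hi0
  induction n generalizing w with
  | zero => exact ⟨0, w, fun i => by simp, i0, by simpa using hn⟩
  | succ n ih =>
    by_cases h : ∃ i, PowerSeries.constantCoeff (w i) ≠ 0
    · exact ⟨0, w, fun i => by simp, h⟩
    · push Not at h
      have h' : ∀ i, ∃ u, w i = PowerSeries.X * u := fun i => PowerSeries.X_dvd_iff.mpr (h i)
      choose w' hw' using h'
      obtain ⟨a, u, h1, h2⟩ := ih w' (by rwa [hw' i0, coeff_succ_X_mul] at hn)
      exact ⟨a + 1, u, fun i => by rw [hw', h1]; ring, h2⟩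

lemma li_lift {ι κ : Type*} [Fintype κ] (v : κ → ι → PowerSeries K)
    (h : LinearIndependent K (fun k i => PowerSeries.constantCoeff (v k i))) :
    LinearIndependent (PowerSeries K) v := by
  rw [Fintype.linearIndependent_iff] at h ⊢
  intro g hg
  by_contra hcon
  push Not at hcon
  obtain ⟨k0, hk0⟩ := hcon
  obtain ⟨a, u, h1, k, h2⟩ := factor_X g (fun h0 => hk0 (by simp [h0]))
  apply h2
  apply h (fun k => PowerSeries.constantCoeff (u k))
  funext i
  have h3 := congrFun hg i
  simp only [Finset.sum_apply, Pi.smul_apply, smul_eq_mul, Pi.zero_apply, h1, mul_assoc,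
    ← Finset.mul_sum] at h3
  have h4 := (mul_eq_zero.mp h3).resolve_left (pow_ne_zero _ PowerSeries.X_ne_zero)
  have h5 := congrArg PowerSeries.constantCoeff h4
  simpa [map_sum] using h5

lemma rank_semicont {r : ℕ} (Q : Matrix (Fin r) (Fin r) (PowerSeries K)) :
    (Q.map PowerSeries.constantCoeff).rank ≤
      (Q.map (algebraMap (PowerSeries K) (FractionRing (PowerSeries K)))).rank := by
  rw [Matrix.rank_eq_finrank_span_cols, Matrix.rank_eq_finrank_span_cols]
  obtain ⟨κ, a, ha, hspan, hli⟩ := exists_linearIndependent' K (Q.map PowerSeries.constantCoeff).col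
  have : Fintype κ := Fintype.ofInjective a ha
  rw [← hspan, finrank_span_eq_card hli]
  have h1 := li_lift (fun k => Q.col (a k)) hli
  have h2 : LinearIndependent (FractionRing (PowerSeries K))
      (fun k => (Q.map (algebraMap (PowerSeries K) (FractionRing (PowerSeries K)))).col (a k)) := by
    rw [← LinearIndependent.iff_fractionRing (R := PowerSeries K)]
    let T : (Fin r → PowerSeries K) →ₗ[PowerSeries K] (Fin r → FractionRing (PowerSeries K)) :=
      LinearMap.pi fun i => (Algebra.linearMap _ _).comp (LinearMap.proj i)
    have hT : LinearMap.ker T = ⊥ := by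
      rw [LinearMap.ker_eq_bot]
      intro x y hxy
      funext i
      exact IsFractionRing.injective (PowerSeries K) (FractionRing (PowerSeries K))
        (congrFun hxy i)
    exact h1.map' T hT
  rw [← finrank_span_eq_card h2]
  apply Submodule.finrank_mono
  apply Submodule.span_mono
  rintro _ ⟨k, rfl⟩
  exact ⟨a k, rfl⟩

lemma trace_eq_rank {L : Type*} [Field L] {r : ℕ} (E : Matrix (Fin r) (Fin r) L)
    (hE : E * E = E) : E.trace = (E.rank : L) := by
  have hp : IsIdempotentElem (Matrix.toLin' E) := by
    unfold IsIdempotentElem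
    rw [Module.End.mul_eq_comp, ← Matrix.toLin'_mul, hE]
  have := (LinearMap.IsIdempotentElem.isProj_range _ hp).trace
  rw [Matrix.trace_toLin'_eq] at this
  exact this

lemma rank_pos_of_ne {L : Type*} [Field L] {r : ℕ} (E : Matrix (Fin r) (Fin r) L)
    (hE : E ≠ 0) : 1 ≤ E.rank := by
  by_contra hcon
  apply hE
  have h0 : E.rank = 0 := by omega
  rw [Matrix.rank, Submodule.finrank_eq_zero, LinearMap.range_eq_bot] at h0
  ext i j
  have := congrFun (congrArg (fun f => f (Pi.single j 1)) h0) i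
  simpa using this

end power

section mainps
open PowerSeries
variable {K : Type*} [Field K] [CharZero K]

lemma smul_pow_cancel {r : ℕ} {b : ℕ} {A B : Matrix (Fin r) (Fin r) (PowerSeries K)}
    (h : (PowerSeries.X : PowerSeries K) ^ b • A = (PowerSeries.X : PowerSeries K) ^ b • B) :
    A = B := by
  ext1 i j
  have := congrFun (congrFun h i) j
  simp only [Matrix.smul_apply, smul_eq_mul] at this
  exact mul_left_cancel₀ (pow_ne_zero _ PowerSeries.X_ne_zero) this

lemma main_ps {r s : ℕ} {ι : Type*} [Fintype ι]
    (P : ι → Matrix (Fin r) (Fin r) (PowerSeries K)) (b : ℕ)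
    (h1 : ∀ i, P i * P i = (PowerSeries.X : PowerSeries K) ^ b • P i)
    (h2 : ∀ i j, i ≠ j → P i * P j = 0)
    (h3 : ∑ i, P i = (PowerSeries.X : PowerSeries K) ^ b • 1)
    (h4 : ∀ i, P i ≠ 0)
    (c : (Fin r →₀ ℕ) → PowerSeries K) (hc : ∀ i, SymM c (P i))
    (emb : Fin s → Fin r) (hemb : Function.Injective emb)
    (hstr : ∀ e, SymM (fun α => PowerSeries.constantCoeff (c α)) e → e * e = e →
      (e.submatrix emb emb = 0 ∨ e.submatrix emb emb = 1))
    (hs : s ≤ r) (hm : r - s + 1 < Fintype.card ι) :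
    ∃ N : Matrix (Fin r) (Fin r) K, SymM (fun α => PowerSeries.constantCoeff (c α)) N ∧ N ≠ 0 ∧ N * N = 0 ∧
      (Fintype.card ι + s - r) * N.rank ≤ s := by
  classical
  let F := FractionRing (PowerSeries K)
  let T : PowerSeries K := PowerSeries.X
  have hT : T ≠ 0 := PowerSeries.X_ne_zero
  have hTb : T ^ b ≠ 0 := pow_ne_zero _ hT
  let am := algebraMap (PowerSeries K) F
  have ham : Function.Injective am := IsFractionRing.injective _ _
  have : CharZero (PowerSeries K) := by
    refine charZero_of_injective_ringHom (f := PowerSeries.C (R := K)) ?_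
    exact PowerSeries.C_injective
  have hamT : am (T ^ b) ≠ 0 := fun h0 => hTb (ham (by simpa using h0))
  let ρ : ι → ℕ := fun i => ((P i).map am).rank
  have hρ1 : ∀ i, 1 ≤ ρ i := by
    intro i
    apply rank_pos_of_ne
    intro h0
    apply h4 i
    ext1 a b
    apply ham
    have := congrFun (congrFun h0 a) b
    simpa using this
  have hρt : ∀ i, (P i).trace = T ^ b * (ρ i : PowerSeries K) := by
    intro i
    apply ham
    let E : Matrix (Fin r) (Fin r) F := (am (T ^ b))⁻¹ • (P i).map am
    have hPE : (P i).map am * (P i).map am = am (T ^ b) • (P i).map am := by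
      rw [← Matrix.map_mul, h1 i]
      ext a b
      simp [T]
    have hE : E * E = E := by
      simp only [E, Matrix.smul_mul, Matrix.mul_smul, hPE, smul_smul]
      rw [inv_mul_cancel₀ hamT, mul_one]
    have hr : E.rank = ρ i :=
      Matrix.rank_smul_of_mem_nonZeroDivisors _
        (mem_nonZeroDivisors_of_ne_zero (inv_ne_zero hamT))
    have ht := trace_eq_rank E hE
    rw [hr, Matrix.trace_smul, smul_eq_mul] at ht
    have h5 : ((P i).map am).trace = am (P i).trace := (AddMonoidHom.map_trace am.toAddMonoidHom _).symm
    rw [h5] at ht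
    rw [map_mul, map_natCast, ← ht, mul_inv_cancel_left₀ hamT]
  -- integral subsets
  have key : ∀ (I : Finset ι) (Q : Matrix (Fin r) (Fin r) (PowerSeries K)),
      ∑ i ∈ I, P i = T ^ b • Q → SymM (fun α => PowerSeries.constantCoeff (c α)) (Q.map PowerSeries.constantCoeff) ∧
        Q.map PowerSeries.constantCoeff * Q.map PowerSeries.constantCoeff = Q.map PowerSeries.constantCoeff ∧
        ∑ i ∈ I, ρ i = (Q.map PowerSeries.constantCoeff).rank := by
    intro I Q hQ
    have hsym : SymM c Q := by
      refine SymM.of_smul hTb ?_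
      rw [← hQ]
      exact SymM.sum I fun i _ => hc i
    have hQQ : Q * Q = Q := by
      apply smul_pow_cancel (b := b)
      apply smul_pow_cancel (b := b)
      have hPP : (∑ i ∈ I, P i) * (∑ i ∈ I, P i) = T ^ b • ∑ i ∈ I, P i := by
        rw [Finset.sum_mul_sum, Finset.smul_sum]
        refine Finset.sum_congr rfl fun i hi => ?_
        rw [Finset.sum_eq_single i, h1]
        · intro j _ hj
          exact h2 i j hj.symm
        · exact fun h => absurd hi h
      rw [hQ] at hPP
      simp only [Matrix.smul_mul, Matrix.mul_smul] at hPP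
      exact hPP
    have hid : Q.map PowerSeries.constantCoeff * Q.map PowerSeries.constantCoeff = Q.map (PowerSeries.constantCoeff (R := K)) := by
      rw [← Matrix.map_mul, hQQ]
    refine ⟨hsym.map _, hid, ?_⟩
    have ht := trace_eq_rank _ hid
    have h5 : (Q.map (PowerSeries.constantCoeff (R := K))).trace = PowerSeries.constantCoeff Q.trace :=
      (AddMonoidHom.map_trace (PowerSeries.constantCoeff (R := K)).toAddMonoidHom _).symm
    have h6 := congrArg Matrix.trace hQ
    rw [Matrix.trace_sum, Matrix.trace_smul, smul_eq_mul, Finset.sum_congr rfl fun i _ => hρt i,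
      ← Finset.mul_sum] at h6
    have h7 := mul_left_cancel₀ hTb h6
    rw [h5, ← h7, ← Nat.cast_sum, map_natCast] at ht
    exact_mod_cast ht
  let good : Finset ι → Prop := fun I => ∃ Q : Matrix (Fin r) (Fin r) (PowerSeries K),
    ∑ i ∈ I, P i = T ^ b • Q ∧ (Q.map PowerSeries.constantCoeff).submatrix emb emb = 1
  have hone : ((1 : Matrix (Fin r) (Fin r) (PowerSeries K)).map PowerSeries.constantCoeff)
      = (1 : Matrix (Fin r) (Fin r) K) := Matrix.map_one _ (map_zero _) (map_one _)
  have hgu : good Finset.univ := by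
    refine ⟨1, h3, ?_⟩
    rw [hone, Matrix.submatrix_one _ hemb]
  have htot : ∑ i, ρ i = r := by
    have := (key Finset.univ 1 h3).2.2
    rw [hone, Matrix.rank_one, Fintype.card_fin] at this
    exact this
  obtain ⟨I, hI, hmin⟩ := Finset.exists_min_image (Finset.univ.filter good) Finset.card
    ⟨Finset.univ, by simpa using hgu⟩
  simp only [Finset.mem_filter, Finset.mem_univ, true_and] at hI hmin
  obtain ⟨Q, hQ, hQ1⟩ := hI
  have hrI : s ≤ ∑ i ∈ I, ρ i := by
    rw [(key I Q hQ).2.2]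
    calc s = ((Q.map PowerSeries.constantCoeff).submatrix emb emb).rank := by
            rw [hQ1, Matrix.rank_one, Fintype.card_fin]
      _ ≤ _ := Matrix.rank_submatrix_le _ _ _
  have hJ : Iᶜ.card ≤ ∑ i ∈ Iᶜ, ρ i := by
    simpa using Finset.card_nsmul_le_sum Iᶜ ρ 1 (fun i _ => hρ1 i)
  have hsplit := Finset.sum_add_sum_compl I ρ
  have hcard := Finset.card_add_card_compl I
  have hI2 : 2 ≤ I.card := by omega
  obtain ⟨i, hi, hmini⟩ := Finset.exists_min_image I ρ (Finset.card_pos.mp (by omega))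
  have hle : I.card * ρ i ≤ ∑ j ∈ I, ρ j := by
    simpa using Finset.card_nsmul_le_sum I ρ (ρ i) hmini
  -- scale P i
  obtain ⟨a, u, hu, ⟨p, hp⟩⟩ := factor_X (fun p : Fin r × Fin r => P i p.1 p.2) (by
    intro h0
    apply h4 i
    ext1 x y
    exact congrFun h0 (x, y))
  let U : Matrix (Fin r) (Fin r) (PowerSeries K) := Matrix.of fun x y => u (x, y)
  have hPU : P i = T ^ a • U := by
    ext1 x y
    exact hu (x, y)
  have hab : a < b := by
    by_contra hba
    push Not at hba
    have hPi : ∑ j ∈ ({i} : Finset ι), P j = T ^ b • (T ^ (a - b) • U) := by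
      rw [Finset.sum_singleton, hPU, smul_smul, ← pow_add, Nat.add_sub_cancel' hba]
    obtain ⟨k1, k2, -⟩ := key _ _ hPi
    rcases hstr _ k1 k2 with h0 | h0
    · have hg : good (I.erase i) := by
        refine ⟨Q - T ^ (a - b) • U, ?_, ?_⟩
        · rw [smul_sub, ← hQ, ← hPi, Finset.sum_singleton, ← Finset.sum_erase_add _ _ hi,
            add_sub_cancel_right]
        · rw [Matrix.map_sub _ (map_sub _), Matrix.submatrix_sub, Pi.sub_apply, Pi.sub_apply, h0,
            hQ1, sub_zero]
      have := hmin _ hg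
      rw [Finset.card_erase_of_mem hi] at this
      omega
    · have := hmin {i} ⟨_, hPi, h0⟩
      simp at this
      omega
  refine ⟨U.map PowerSeries.constantCoeff, ?_, ?_, ?_, ?_⟩
  · refine SymM.map _ ?_
    refine SymM.of_smul (pow_ne_zero a hT) ?_
    rw [← hPU]
    exact hc i
  · intro h0
    apply hp
    have := congrFun (congrFun h0 p.1) p.2
    simpa [U] using this
  · have hUU : U * U = T ^ (b - a) • U := by
      apply smul_pow_cancel (b := a)
      apply smul_pow_cancel (b := a)
      have := h1 i
      rw [hPU] at this
      simp only [Matrix.smul_mul, Matrix.mul_smul] at this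
      rw [this]
      change T ^ b • T ^ a • U = T ^ a • T ^ a • T ^ (b - a) • U
      simp only [smul_smul, ← pow_add]
      congr 2
      omega
    rw [← Matrix.map_mul, hUU]
    ext x y
    simp [T, show b - a ≠ 0 by omega]
  · have hrk : (U.map PowerSeries.constantCoeff).rank ≤ ρ i := by
      refine (rank_semicont U).trans (le_of_eq ?_)
      have : (P i).map am = am (T ^ a) • U.map am := by
        rw [hPU]; ext x y; simp [T]
      change _ = ((P i).map am).rank
      rw [this]
      exact (Matrix.rank_smul_of_mem_nonZeroDivisors _ (mem_nonZeroDivisors_of_ne_zero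
        (fun h0 => pow_ne_zero a hT (ham (by simpa using h0))))).symm
    have hρi := hρ1 i
    obtain ⟨w, hw⟩ := exists_add_of_le hrI
    obtain ⟨k, hk⟩ : ∃ k, k = Fintype.card ι + s - r := ⟨_, rfl⟩
    rw [← hk]
    have hkI : k + w ≤ I.card := by omega
    have hA : k * (U.map PowerSeries.constantCoeff).rank ≤ k * ρ i := Nat.mul_le_mul_left _ hrk
    have hB : (k + w) * ρ i ≤ s + w := by
      calc (k + w) * ρ i ≤ I.card * ρ i := Nat.mul_le_mul_right _ hkI
        _ ≤ _ := by rw [← hw]; exact hle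
    have hC : w ≤ w * ρ i := Nat.le_mul_of_pos_right _ hρi
    rw [add_mul] at hB
    omega

end mainps

section potential
variable {K : Type*} [Field K] [CharZero K] {s d : ℕ}

lemma dv_of_degree_ne {h : MvPolynomial (Fin s) K} (hd : 1 ≤ d) (hh : h.IsHomogeneous d)
    (u : Fin s → K) {β : Fin s →₀ ℕ} (hβ : β.degree ≠ d - 1) : dv (cc h) u β = 0 := by
  refine Finset.sum_eq_zero fun k _ => ?_
  rw [cc_of_degree_ne hh, mul_zero]
  rw [map_add, Finsupp.degree_single]; omega

lemma exists_potential (hd : 1 ≤ d) {h : MvPolynomial (Fin s) K} (hh : h.IsHomogeneous d)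
    {A : Matrix (Fin s) (Fin s) K} (hA : SymM (cc h) A) :
    ∃ g : MvPolynomial (Fin s) K, g.IsHomogeneous d ∧
      ∀ i β, cc g (β + Finsupp.single i 1) = dv (cc h) (A i) β := by
  let q : Fin s → MvPolynomial (Fin s) K := fun i => ∑ k, C (A i k) * pderiv k h
  have hq : ∀ i β, cc (q i) β = dv (cc h) (A i) β := by
    intro i β
    simp only [q, cc_sum, dv]
    refine Finset.sum_congr rfl fun k _ => ?_
    rw [← cc_pderiv]
    simp [cc, coeff_C_mul]; ring
  have hqh : ∀ i, (q i).IsHomogeneous (d - 1) := by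
    intro i
    refine isHomogeneous_of_cc fun α hα => ?_
    rw [hq, dv_of_degree_ne hd hh _ hα]
  have hqs : ∀ i j, pderiv j (q i) = pderiv i (q j) := by
    intro i j
    refine ext_cc fun α => ?_
    rw [cc_pderiv, cc_pderiv, hq, hq]
    exact hA j i α
  have hgp : ∀ j, pderiv j (C ((d : K)⁻¹) * ∑ i, X i * q i) = q j := by
    intro j
    rw [pderiv_C_mul, map_sum]
    have h1 : ∑ i, pderiv j (X i * q i) = (d : K) • q j := by
      have h2 : ∀ i, pderiv j (X i * q i) = (if i = j then q j else 0) + X i * pderiv i (q j) := by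
        intro i
        rw [pderiv_mul, pderiv_X, hqs i j]
        by_cases hij : i = j
        · subst hij; simp
        · simp [hij, Pi.single_apply, Ne.symm hij]
      rw [Finset.sum_congr rfl fun i _ => h2 i, Finset.sum_add_distrib,
        (hqh j).sum_X_mul_pderiv]
      simp only [Finset.sum_ite_eq', Finset.mem_univ, if_true]
      obtain ⟨e, rfl⟩ : ∃ e, d = e + 1 := ⟨d - 1, by omega⟩
      rw [Nat.add_sub_cancel, ← Nat.cast_smul_eq_nsmul K, Nat.cast_add, Nat.cast_one, add_smul, one_smul, add_comm]
    rw [h1]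
    have hd0 : (d : K) ≠ 0 := by exact_mod_cast (by omega : d ≠ 0)
    simp [smul_smul, hd0, ← smul_eq_C_mul]
  refine ⟨C ((d : K)⁻¹) * ∑ i, X i * q i, ?_, ?_⟩
  · have h1 : (∑ i, X i * q i).IsHomogeneous d := by
      apply IsHomogeneous.sum
      intro i _
      have := (isHomogeneous_X K i).mul (hqh i)
      rwa [Nat.add_sub_cancel' hd] at this
    simpa using (isHomogeneous_C (Fin s) ((d : K)⁻¹)).mul h1
  · intro i β
    rw [← cc_pderiv, hgp, hq]

lemma partials_prop {g h : MvPolynomial (Fin s) K} {e : Matrix (Fin s) (Fin s) K}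
    (hee : e * e = e) (hd : 1 ≤ d) (hg : g.IsHomogeneous d)
    (hgh : ∀ i β, cc g (β + Finsupp.single i 1) = dv (cc h) (e i) β)
    {w : MvPolynomial (Fin s) K} (hw : w ∈ partials (d - 1) g) :
    w.IsHomogeneous 1 ∧ ∀ i, cc w (Finsupp.single i 1) = ∑ k, e i k * cc w (Finsupp.single k 1) := by
  have hrel : ∀ i β, cc g (β + Finsupp.single i 1)
      = ∑ k, e i k * cc g (β + Finsupp.single k 1) := by
    intro i β
    rw [hgh]
    conv_lhs => rw [← hee]
    rw [dv_mul]
    exact Finset.sum_congr rfl fun k _ => by rw [hgh]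
  unfold partials at hw
  induction hw using Submodule.span_induction with
  | mem x hx =>
    obtain ⟨D, hD, rfl⟩ := hx
    constructor
    · refine isHomogeneous_of_cc fun α hα => ?_
      rw [cc_contract]
      refine Finset.sum_eq_zero fun β hβ => ?_
      have hdeg : β.degree = d - 1 := by
        by_contra hne
        exact (mem_support_iff.mp hβ) (hD.coeff_eq_zero hne)
      rw [cc_of_degree_ne hg, mul_zero]
      rw [map_add]; omega
    · intro i
      simp only [cc_contract, Finset.mul_sum]
      rw [Finset.sum_comm]
      refine Finset.sum_congr rfl fun β _ => ?_
      rw [add_comm, hrel, Finset.mul_sum]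
      refine Finset.sum_congr rfl fun k _ => ?_
      rw [add_comm]; ring
  | zero => exact ⟨isHomogeneous_zero _ _ _, fun i => by simp [cc_zero]⟩
  | add x y _ _ hx hy =>
    refine ⟨hx.1.add hy.1, fun i => ?_⟩
    simp only [cc_add, mul_add, Finset.sum_add_distrib]
    rw [← hx.2, ← hy.2]
  | smul a x _ hx =>
    have hcs : ∀ α, cc (a • x) α = a * cc x α := by
      intro α; simp [cc]; ring
    refine ⟨?_, fun i => ?_⟩
    · rw [smul_eq_C_mul]
      simpa using (isHomogeneous_C (Fin s) a).mul hx.1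
    · simp only [hcs]
      rw [hx.2, Finset.mul_sum]
      exact Finset.sum_congr rfl fun k _ => by ring

lemma partials_disjoint {g1 g2 h : MvPolynomial (Fin s) K} {e1 e2 : Matrix (Fin s) (Fin s) K}
    (h11 : e1 * e1 = e1) (h22 : e2 * e2 = e2) (h12 : e1 * e2 = 0)
    (hd : 1 ≤ d) (hg1 : g1.IsHomogeneous d) (hg2 : g2.IsHomogeneous d)
    (hgh1 : ∀ i β, cc g1 (β + Finsupp.single i 1) = dv (cc h) (e1 i) β)
    (hgh2 : ∀ i β, cc g2 (β + Finsupp.single i 1) = dv (cc h) (e2 i) β) :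
    Disjoint (partials (d - 1) g1) (partials (d - 1) g2) := by
  rw [Submodule.disjoint_def]
  intro w hw1 hw2
  obtain ⟨hom, p1⟩ := partials_prop h11 hd hg1 hgh1 hw1
  obtain ⟨-, p2⟩ := partials_prop h22 hd hg2 hgh2 hw2
  rw [linear_form hom]
  refine Finset.sum_eq_zero fun i _ => ?_
  have q1 : (fun i => cc w (Finsupp.single i 1)) = e1.mulVec (fun i => cc w (Finsupp.single i 1)) := by
    funext i; exact p1 i
  have q2 : (fun i => cc w (Finsupp.single i 1)) = e2.mulVec (fun i => cc w (Finsupp.single i 1)) := by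
    funext i; exact p2 i
  have q3 : (fun i => cc w (Finsupp.single i 1)) = 0 := by
    rw [q1, q2, Matrix.mulVec_mulVec, h12, Matrix.zero_mulVec]
  have := congrFun q3 i
  simp only [Pi.zero_apply] at this
  rw [this, zero_smul]

lemma idem_trivial (hd : 1 ≤ d) {h : MvPolynomial (Fin s) K} (hh : h.IsHomogeneous d)
    (hnd : Nondeg (cc h))
    (hnosplit : ¬ ∃ G : Set (MvPolynomial (Fin s) K), IsRegSplit d h G ∧ 2 ≤ G.ncard)
    {e : Matrix (Fin s) (Fin s) K} (he : SymM (cc h) e) (hee : e * e = e) : e = 0 ∨ e = 1 := by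
  by_contra hcon
  push Not at hcon
  obtain ⟨he0, he1⟩ := hcon
  apply hnosplit
  have hne : ∀ (g : MvPolynomial (Fin s) K) (e : Matrix (Fin s) (Fin s) K), e ≠ 0 →
      (∀ i β, cc g (β + Finsupp.single i 1) = dv (cc h) (e i) β) → g ≠ 0 := by
    rintro g e he hg rfl
    apply he
    funext i
    apply hnd
    intro β
    rw [← hg, cc_zero]
  set e2 := 1 - e with he2
  have h22 : e2 * e2 = e2 := by
    rw [he2, mul_sub, mul_one, sub_mul, one_mul, hee, sub_self, sub_zero]
  have h12 : e * e2 = 0 := by rw [he2, mul_sub, mul_one, hee, sub_self]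
  have h21 : e2 * e = 0 := by rw [he2, sub_mul, one_mul, hee, sub_self]
  have he20 : e2 ≠ 0 := fun h0 => he1 (sub_eq_zero.mp h0).symm
  obtain ⟨g1, hg1, hgh1⟩ := exists_potential hd hh he
  obtain ⟨g2, hg2, hgh2⟩ := exists_potential hd hh he.one_sub
  rw [← he2] at hgh2
  have hg10 := hne g1 e he0 hgh1
  have hg20 := hne g2 e2 he20 hgh2
  have hg12 : g1 ≠ g2 := by
    rintro rfl
    have : e = e2 := by
      funext i
      rw [← sub_eq_zero]
      apply hnd
      intro β
      rw [dv_sub, ← hgh1, ← hgh2, sub_self]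
    rw [← this, hee] at h12
    exact he0 h12
  have hsum : g1 + g2 = h := by
    rw [← sub_eq_zero]
    by_contra hne0
    have hhom : (g1 + g2 - h).IsHomogeneous d := (hg1.add hg2).sub hh
    obtain ⟨i, β, hi⟩ := exists_deriv_ne hd hhom hne0
    apply hi
    have h5 := cc_add (g1 + g2 - h) h (β + Finsupp.single i 1)
    rw [sub_add_cancel, cc_add, hgh1, hgh2] at h5
    have h6 : dv (cc h) (e2 i) β = cc h (β + Finsupp.single i 1) - dv (cc h) (e i) β := by
      rw [← dv_one (cc h) i β, ← dv_sub]; rfl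
    rw [h6] at h5
    linear_combination -h5
  refine ⟨{g1, g2}, ⟨by simp, by simp, ?_, ?_, ?_⟩, ?_⟩
  · rintro g (rfl | rfl)
    · exact ⟨hg10, hg1⟩
    · exact ⟨hg20, hg2⟩
  · rw [finsum_mem_pair hg12, hsum]
  · rintro g (rfl | rfl)
    · refine (partials_disjoint hee h22 h12 hd hg1 hg2 hgh1 hgh2).mono_right ?_
      refine iSup₂_le ?_
      rintro x ⟨rfl | rfl, hx⟩
      · simp at hx
      · exact le_rfl
    · refine (partials_disjoint h22 hee h21 hd hg2 hg1 hgh2 hgh1).mono_right ?_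
      refine iSup₂_le ?_
      rintro x ⟨rfl | rfl, hx⟩
      · exact le_rfl
      · simp at hx
  · rw [Set.ncard_pair hg12]

end potential

section structF
variable {K : Type*} [Field K] [CharZero K] {r s d : ℕ}

lemma cc_pow (i : Fin r) (α : Fin r →₀ ℕ) :
    cc ((d.factorial : K)⁻¹ • (X i ^ d : MvPolynomial (Fin r) K)) α
      = if α = Finsupp.single i d then 1 else 0 := by
  classical
  unfold cc
  rw [coeff_smul, X_pow_eq_monomial, coeff_monomial]
  by_cases h : α = Finsupp.single i d
  · subst h
    have h1 : (∏ j, (((Finsupp.single i d : Fin r →₀ ℕ) j).factorial : K)) = d.factorial := by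
      rw [Finset.prod_eq_single i]
      · simp
      · intro j _ hj
        simp [Finsupp.single_eq_of_ne hj]
      · simp
    rw [h1]
    have : (d.factorial : K) ≠ 0 := by exact_mod_cast Nat.factorial_ne_zero d
    simp [this]
  · rw [if_neg h, if_neg (Ne.symm h)]
    simp

lemma cc_f_emb (hs : s ≤ r) (hd : 1 ≤ d) (h : MvPolynomial (Fin s) K)
    (f : MvPolynomial (Fin r) K)
    (hf : f = MvPolynomial.rename (Fin.castLE hs) h +
      ∑ i ∈ Finset.univ.filter (fun i : Fin r => s ≤ (i : ℕ)),
        (((d.factorial : K))⁻¹ • X i ^ d)) (β : Fin s →₀ ℕ) :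
    cc f (Finsupp.mapDomain (Fin.castLE hs) β) = cc h β := by
  have hinj : Function.Injective (Fin.castLE hs) := Fin.castLE_injective hs
  rw [hf, cc_add, cc_sum, Finset.sum_eq_zero, add_zero]
  · unfold cc
    rw [coeff_rename_mapDomain _ hinj]
    congr 1
    symm
    refine Fintype.prod_of_injective _ hinj _ _ ?_ ?_
    · intro i hi
      rw [Finsupp.mapDomain_of_notMem_range _ _ hi]; simp
    · intro i
      rw [Finsupp.mapDomain_apply hinj]
  · intro i hi
    rw [cc_pow, if_neg]
    intro h0
    have h1 := DFunLike.congr_fun h0 i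
    rw [Finsupp.mapDomain_of_notMem_range, Finsupp.single_eq_same] at h1
    · omega
    · rintro ⟨k, rfl⟩
      simp only [Finset.mem_filter, Fin.val_castLE] at hi
      have := k.2
      omega

lemma cc_f_out (hs : s ≤ r) (h : MvPolynomial (Fin s) K)
    (f : MvPolynomial (Fin r) K)
    (hf : f = MvPolynomial.rename (Fin.castLE hs) h +
      ∑ i ∈ Finset.univ.filter (fun i : Fin r => s ≤ (i : ℕ)),
        (((d.factorial : K))⁻¹ • X i ^ d)) (i : Fin r) (hi : i ∉ Set.range (Fin.castLE hs))
    (α : Fin r →₀ ℕ) :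
    cc f (α + Finsupp.single i 1) = if α + Finsupp.single i 1 = Finsupp.single i d then 1 else 0 := by
  have his : s ≤ (i : ℕ) := by
    by_contra hlt
    exact hi ⟨⟨i, by omega⟩, by ext; rfl⟩
  rw [hf, cc_add, cc_sum, Finset.sum_eq_single i]
  · rw [cc_pow]
    have : cc (rename (Fin.castLE hs) h) (α + Finsupp.single i 1) = 0 := by
      rw [cc_eq_zero_iff]
      apply coeff_rename_eq_zero
      intro u hu
      have h1 := DFunLike.congr_fun hu i
      rw [Finsupp.mapDomain_of_notMem_range _ _ hi] at h1
      simp at h1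
    rw [this, zero_add]
  · intro j _ hj
    rw [cc_pow, if_neg]
    intro h0
    have h1 := DFunLike.congr_fun h0 i
    rw [Finsupp.single_eq_of_ne (Ne.symm hj)] at h1
    simp at h1
  · intro h0
    simp [his] at h0

variable {c : (Fin r →₀ ℕ) → K} {c' : (Fin s →₀ ℕ) → K} {emb : Fin s → Fin r}

lemma dv_out (hd : 2 ≤ d)
    (hb : ∀ i ∉ Set.range emb, ∀ α, c (α + Finsupp.single i 1)
      = if α + Finsupp.single i 1 = Finsupp.single i d then 1 else 0)
    {i : Fin r} (hi : i ∉ Set.range emb) (u : Fin r → K) (α : Fin r →₀ ℕ) :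
    dv c u (α + Finsupp.single i 1) = if α = Finsupp.single i (d - 2) then u i else 0 := by
  unfold dv
  have hsd : (Finsupp.single i d : Fin r →₀ ℕ) = Finsupp.single i (d - 2) + Finsupp.single i 1
      + Finsupp.single i 1 := by
    rw [← Finsupp.single_add, ← Finsupp.single_add]
    congr 1; omega
  rw [Finset.sum_eq_single i]
  · rw [hb i hi, hsd]
    simp only [add_left_inj]
    split_ifs <;> simp
  · intro k _ hk
    rw [add_right_comm, hb i hi, if_neg, mul_zero]
    intro h0
    have h1 := DFunLike.congr_fun h0 k
    rw [Finsupp.single_eq_of_ne hk] at h1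
    simp at h1
  · simp

lemma dv_in (hemb : Function.Injective emb) (hd : 2 ≤ d)
    (ha : ∀ β, c (Finsupp.mapDomain emb β) = c' β)
    (hb : ∀ i ∉ Set.range emb, ∀ α, c (α + Finsupp.single i 1)
      = if α + Finsupp.single i 1 = Finsupp.single i d then 1 else 0)
    (u : Fin r → K) (β : Fin s →₀ ℕ) :
    dv c u (Finsupp.mapDomain emb β) = dv c' (u ∘ emb) β := by
  unfold dv
  symm
  refine Fintype.sum_of_injective _ hemb _ _ ?_ ?_
  · intro i hi
    rw [hb i hi, if_neg, mul_zero]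
    intro h0
    have h1 := DFunLike.congr_fun h0 i
    rw [Finsupp.single_eq_same, Finsupp.add_apply, Finsupp.mapDomain_of_notMem_range _ _ hi] at h1
    simp at h1
    omega
  · intro i
    rw [← ha, Finsupp.mapDomain_add, Finsupp.mapDomain_single]
    rfl

lemma nondeg_f (hemb : Function.Injective emb) (hd : 2 ≤ d)
    (ha : ∀ β, c (Finsupp.mapDomain emb β) = c' β)
    (hb : ∀ i ∉ Set.range emb, ∀ α, c (α + Finsupp.single i 1)
      = if α + Finsupp.single i 1 = Finsupp.single i d then 1 else 0)
    (hnd : Nondeg c') : Nondeg c := by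
  intro v hv
  have h1 : v ∘ emb = 0 := hnd _ fun β => by rw [← dv_in hemb hd ha hb, hv]
  funext i
  by_cases hi : i ∈ Set.range emb
  · obtain ⟨k, rfl⟩ := hi
    exact congrFun h1 k
  · have := hv (Finsupp.single i (d - 2) + Finsupp.single i 1)
    rw [dv_out hd hb hi, if_pos rfl] at this
    exact this

lemma sym_struct (hemb : Function.Injective emb) (hd : 3 ≤ d)
    (ha : ∀ β, c (Finsupp.mapDomain emb β) = c' β)
    (hb : ∀ i ∉ Set.range emb, ∀ α, c (α + Finsupp.single i 1)
      = if α + Finsupp.single i 1 = Finsupp.single i d then 1 else 0)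
    (hnd : Nondeg c') (hc0 : ∀ u, dv c' u 0 = 0)
    {A : Matrix (Fin r) (Fin r) K} (hA : SymM c A) :
    (∀ i, ∀ j ∉ Set.range emb, i ≠ j → A i j = 0) ∧
    (∀ j ∉ Set.range emb, ∀ i, i ≠ j → A j i = 0) ∧
    SymM c' (A.submatrix emb emb) := by
  have p1 : ∀ i, ∀ j ∉ Set.range emb, i ≠ j → A i j = 0 := by
    intro i j hj hij
    have h1 := hA i j (Finsupp.single j (d - 2))
    rw [dv_out (by omega) hb hj, if_pos rfl] at h1
    have h2 : (Finsupp.single j (d - 2) : Fin r →₀ ℕ) + Finsupp.single i 1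
        = (Finsupp.single j (d - 3) + Finsupp.single i 1) + Finsupp.single j 1 := by
      rw [add_right_comm, ← Finsupp.single_add]
      congr 2; omega
    rw [h2, dv_out (by omega) hb hj, if_neg] at h1
    · exact h1.symm
    · intro h0
      have h3 := DFunLike.congr_fun h0 i
      rw [Finsupp.single_eq_of_ne hij] at h3
      simp at h3
  refine ⟨p1, ?_, ?_⟩
  · intro j hj i hij
    by_cases hi : i ∈ Set.range emb
    · obtain ⟨k, rfl⟩ := hi
      suffices h : A j ∘ emb = 0 from congrFun h k
      apply hnd
      intro β
      by_cases hβ : β = 0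
      · rw [hβ]; exact hc0 _
      · obtain ⟨l, hl⟩ := Finsupp.ne_iff.mp hβ
        have hle : Finsupp.single l 1 ≤ β := by
          rw [Finsupp.single_le_iff]
          exact Nat.one_le_iff_ne_zero.mpr hl
        obtain ⟨γ, rfl⟩ := exists_add_of_le hle
        rw [← dv_in hemb (by omega) ha hb, add_comm, Finsupp.mapDomain_add,
          Finsupp.mapDomain_single, hA, dv_out (by omega) hb hj, if_neg]
        intro h0
        have h3 := DFunLike.congr_fun h0 j
        rw [Finsupp.single_eq_same, Finsupp.mapDomain_of_notMem_range _ _ hj] at h3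
        omega
    · exact p1 j i hi (Ne.symm hij)
  · intro i j α
    have h1 := hA (emb i) (emb j) (Finsupp.mapDomain emb α)
    rw [← Finsupp.mapDomain_single, ← Finsupp.mapDomain_single, ← Finsupp.mapDomain_add,
      ← Finsupp.mapDomain_add, dv_in hemb (by omega) ha hb, dv_in hemb (by omega) ha hb] at h1
    exact h1

lemma submatrix_mul_self (hemb : Function.Injective emb) {A : Matrix (Fin r) (Fin r) K}
    (p1 : ∀ i, ∀ j ∉ Set.range emb, i ≠ j → A i j = 0) :
    A.submatrix emb emb * A.submatrix emb emb = (A * A).submatrix emb emb := by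
  ext i j
  rw [Matrix.mul_apply, Matrix.submatrix_apply, Matrix.mul_apply]
  refine Fintype.sum_of_injective _ hemb _ _ ?_ ?_
  · intro k hk
    rw [p1 _ k hk, zero_mul]
    rintro rfl
    exact hk ⟨i, rfl⟩
  · intro k; rfl

lemma submatrix_ne_zero {N : Matrix (Fin r) (Fin r) K}
    (p1 : ∀ i, ∀ j ∉ Set.range emb, i ≠ j → N i j = 0)
    (p2 : ∀ j ∉ Set.range emb, ∀ i, i ≠ j → N j i = 0)
    (hN : N ≠ 0) (hNN : N * N = 0) : N.submatrix emb emb ≠ 0 := by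
  intro h0
  apply hN
  ext i j
  by_cases hi : i ∈ Set.range emb
  · by_cases hj : j ∈ Set.range emb
    · obtain ⟨k, rfl⟩ := hi
      obtain ⟨l, rfl⟩ := hj
      exact congrFun (congrFun h0 k) l
    · exact p1 _ _ hj (fun h => hj (h ▸ hi))
  · by_cases hij : j = i
    · subst hij
      have h1 := congrFun (congrFun hNN j) j
      rw [Matrix.mul_apply, Finset.sum_eq_single j] at h1
      · simpa using h1
      · intro k _ hk
        rw [p2 j hi k hk, zero_mul]
      · simp
    · exact p2 _ hi _ hij

/-- the degenerate case -/
lemma degenerate_case (h : MvPolynomial (Fin s) K) (hs2 : 2 ≤ s) (hnd : ¬ Nondeg (cc h)) :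
    ∃ B : Matrix (Fin s) (Fin s) K, B ∈ Mf h ∧ B ≠ 0 ∧ IsNilpotent B ∧ B.rank ≤ 1 := by
  unfold Nondeg at hnd
  push Not at hnd
  obtain ⟨v, hv, hv0⟩ := hnd
  obtain ⟨u, hu0, huv⟩ : ∃ u : Fin s → K, u ≠ 0 ∧ v ⬝ᵥ u = 0 := by
    obtain ⟨i, hi⟩ := Function.ne_iff.mp hv0
    have : Nontrivial (Fin s) := Fin.nontrivial_iff_two_le.mpr hs2
    obtain ⟨j, hj⟩ := exists_ne i
    refine ⟨Pi.single j (v i) - Pi.single i (v j), ?_, ?_⟩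
    · intro h0
      have := congrFun h0 j
      simp [hj] at this
      exact hi this
    · rw [dotProduct_sub, dotProduct_single, dotProduct_single, mul_comm, sub_self]
  refine ⟨Matrix.vecMulVec u v, ?_, ?_, ⟨2, ?_⟩, Matrix.rank_vecMulVec_le _ _⟩
  · rw [mem_Mf_iff]
    have : ∀ j β, dv (cc h) (Matrix.vecMulVec u v j) β = 0 := by
      intro j β
      have : Matrix.vecMulVec u v j = u j • v := by
        ext k; simp [Matrix.vecMulVec_apply]
      rw [this, dv_smul, hv, mul_zero]
    intro i j α
    rw [this, this]
  · obtain ⟨i, hi⟩ := Function.ne_iff.mp hv0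
    obtain ⟨j, hj⟩ := Function.ne_iff.mp hu0
    intro h0
    have := congrFun (congrFun h0 j) i
    rw [Matrix.vecMulVec_apply] at this
    exact mul_ne_zero hj hi this
  · rw [sq, Matrix.vecMulVec_mul_vecMulVec, huv]
    ext i j
    simp [Matrix.vecMulVec_apply]

/-- nondegeneracy lifts to the generic fibre -/
lemma nondeg_generic {n : ℕ} (ct : (Fin r →₀ ℕ) → MvPolynomial (Fin n) K)
    (hnd : Nondeg (fun α => MvPolynomial.eval (0 : Fin n → K) (ct α))) :
    Nondeg (fun α => algebraMap (MvPolynomial (Fin n) K)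
      (FractionRing (MvPolynomial (Fin n) K)) (ct α)) := by
  intro v hv
  by_contra hv0
  obtain ⟨b, hb⟩ := IsLocalization.exist_integer_multiples_of_finite
    (nonZeroDivisors (MvPolynomial (Fin n) K)) v
  choose w hw using hb
  have hb0 : (b : MvPolynomial (Fin n) K) ≠ 0 := nonZeroDivisors.coe_ne_zero b
  have hinj := IsFractionRing.injective (MvPolynomial (Fin n) K)
    (FractionRing (MvPolynomial (Fin n) K))
  have hw1 : ∀ β, dv ct w β = 0 := by
    intro β
    apply hinj
    rw [← dv_map, map_zero]
    have : (fun k => algebraMap (MvPolynomial (Fin n) K)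
        (FractionRing (MvPolynomial (Fin n) K)) (w k))
        = (algebraMap _ (FractionRing (MvPolynomial (Fin n) K)) (b : MvPolynomial (Fin n) K)) • v := by
      funext k
      rw [hw, Pi.smul_apply, Algebra.smul_def, smul_eq_mul]
    rw [this, dv_smul, hv, mul_zero]
  obtain ⟨i, hi⟩ := Function.ne_iff.mp hv0
  have hwi : w i ≠ 0 := by
    intro h0
    have h1 := hw i
    rw [h0, map_zero, Algebra.smul_def] at h1
    refine mul_ne_zero ?_ hi h1.symm
    rw [Ne, ← map_zero (algebraMap (MvPolynomial (Fin n) K) _)]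
    exact fun h => hb0 (hinj h)
  obtain ⟨φ, hφ, hφ0⟩ := exists_line (w i) hwi
  obtain ⟨a, u, hu, k, hk⟩ := factor_X (fun i => φ (w i)) (fun h => hφ (congrFun h i))
  apply hk
  have hu0 : (fun i => PowerSeries.constantCoeff (u i)) = 0 := by
    apply hnd
    intro β
    have h1 : dv (fun α => φ (ct α)) u β = 0 := by
      have h2 := congrArg φ (hw1 β)
      rw [← dv_map, map_zero] at h2
      have h3 : (fun k => φ (w k)) = (PowerSeries.X ^ a : PowerSeries K) • u := by
        funext k; rw [hu]; rfl
      rw [h3, dv_smul] at h2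
      exact (mul_eq_zero.mp h2).resolve_left (pow_ne_zero _ PowerSeries.X_ne_zero)
    have h4 := congrArg (PowerSeries.constantCoeff (R := K)) h1
    rw [← dv_map, map_zero] at h4
    simpa only [hφ0] using h4
  exact congrFun hu0 k

/-- specialise the idempotents to a line -/
lemma specialise {n : ℕ} {ι : Type*} [Fintype ι] (ct : (Fin r →₀ ℕ) → MvPolynomial (Fin n) K)
    (E : ι → Matrix (Fin r) (Fin r) (FractionRing (MvPolynomial (Fin n) K)))
    (hE : ∀ g, SymM (fun α => algebraMap (MvPolynomial (Fin n) K)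
      (FractionRing (MvPolynomial (Fin n) K)) (ct α)) (E g))
    (h1 : ∀ g, E g * E g = E g) (h2 : ∀ g h, g ≠ h → E g * E h = 0)
    (h3 : ∑ g, E g = 1) (h4 : ∀ g, E g ≠ 0) :
    ∃ (φ : MvPolynomial (Fin n) K →+* PowerSeries K) (b : ℕ)
      (P : ι → Matrix (Fin r) (Fin r) (PowerSeries K)),
      (∀ p, PowerSeries.constantCoeff (φ p) = MvPolynomial.eval (0 : Fin n → K) p) ∧
      (∀ g, P g * P g = (PowerSeries.X ^ b : PowerSeries K) • P g) ∧
      (∀ g h, g ≠ h → P g * P h = 0) ∧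
      ∑ g, P g = (PowerSeries.X ^ b : PowerSeries K) • 1 ∧
      (∀ g, P g ≠ 0) ∧ ∀ g, SymM (fun α => φ (ct α)) (P g) := by
  classical
  obtain ⟨D, hD⟩ := IsLocalization.exist_integer_multiples_of_finite
    (nonZeroDivisors (MvPolynomial (Fin n) K)) (fun x : ι × Fin r × Fin r => E x.1 x.2.1 x.2.2)
  choose w hw using hD
  have hD0 : (D : (MvPolynomial (Fin n) K)) ≠ 0 := nonZeroDivisors.coe_ne_zero D
  have hinj : Function.Injective (algebraMap (MvPolynomial (Fin n) K) (FractionRing (MvPolynomial (Fin n) K))) := IsFractionRing.injective (MvPolynomial (Fin n) K) (FractionRing (MvPolynomial (Fin n) K))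
  let Q : ι → Matrix (Fin r) (Fin r) (MvPolynomial (Fin n) K) := fun g => Matrix.of fun i j => w (g, i, j)
  let δ : (FractionRing (MvPolynomial (Fin n) K)) := algebraMap (MvPolynomial (Fin n) K) (FractionRing (MvPolynomial (Fin n) K)) D
  have hδ : δ ≠ 0 := fun h => hD0 (hinj (h.trans (map_zero _).symm))
  have hQ : ∀ g, (Q g).map (algebraMap (MvPolynomial (Fin n) K) (FractionRing (MvPolynomial (Fin n) K))) = δ • E g := by
    intro g
    ext i j
    change algebraMap (MvPolynomial (Fin n) K) (FractionRing (MvPolynomial (Fin n) K)) (w (g, i, j)) = _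
    rw [hw, Algebra.smul_def]
    rfl
  have hminj : Function.Injective (fun M : Matrix (Fin r) (Fin r) (MvPolynomial (Fin n) K) => M.map (algebraMap (MvPolynomial (Fin n) K) (FractionRing (MvPolynomial (Fin n) K)))) :=
    Matrix.map_injective hinj
  have hsm : ∀ M : Matrix (Fin r) (Fin r) (MvPolynomial (Fin n) K),
      ((D : (MvPolynomial (Fin n) K)) • M).map (algebraMap (MvPolynomial (Fin n) K) (FractionRing (MvPolynomial (Fin n) K))) = δ • M.map (algebraMap (MvPolynomial (Fin n) K) (FractionRing (MvPolynomial (Fin n) K))) := by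
    intro M; ext i j; simp [δ]
  have q1 : ∀ g, Q g * Q g = (D : (MvPolynomial (Fin n) K)) • Q g := by
    intro g
    apply hminj
    change (Q g * Q g).map (algebraMap (MvPolynomial (Fin n) K) (FractionRing (MvPolynomial (Fin n) K))) = ((D : (MvPolynomial (Fin n) K)) • Q g).map (algebraMap (MvPolynomial (Fin n) K) (FractionRing (MvPolynomial (Fin n) K)))
    rw [hsm, Matrix.map_mul, hQ, smul_mul_smul_comm, h1, smul_smul]
  have q2 : ∀ g h, g ≠ h → Q g * Q h = 0 := by
    intro g h hgh
    apply hminj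
    change (Q g * Q h).map (algebraMap (MvPolynomial (Fin n) K) (FractionRing (MvPolynomial (Fin n) K))) = (0 : Matrix (Fin r) (Fin r) (MvPolynomial (Fin n) K)).map (algebraMap (MvPolynomial (Fin n) K) (FractionRing (MvPolynomial (Fin n) K)))
    rw [Matrix.map_mul, hQ, hQ, smul_mul_smul_comm, h2 g h hgh, smul_zero]
    ext i j; simp
  have q3 : ∑ g, Q g = (D : (MvPolynomial (Fin n) K)) • 1 := by
    apply hminj
    change (∑ g, Q g).map (algebraMap (MvPolynomial (Fin n) K) (FractionRing (MvPolynomial (Fin n) K)))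
      = ((D : (MvPolynomial (Fin n) K)) • (1 : Matrix (Fin r) (Fin r) (MvPolynomial (Fin n) K))).map (algebraMap (MvPolynomial (Fin n) K) (FractionRing (MvPolynomial (Fin n) K)))
    have hx : (∑ g, Q g).map (algebraMap (MvPolynomial (Fin n) K) (FractionRing (MvPolynomial (Fin n) K))) = ∑ g, (Q g).map (algebraMap (MvPolynomial (Fin n) K) (FractionRing (MvPolynomial (Fin n) K))) := by
      exact map_sum (algebraMap (MvPolynomial (Fin n) K) (FractionRing (MvPolynomial (Fin n) K))).mapMatrix _ _
    rw [hsm, hx, Finset.sum_congr rfl (fun g _ => hQ g), ← Finset.smul_sum, h3]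
    congr 1
    exact (map_one (algebraMap (MvPolynomial (Fin n) K) (FractionRing (MvPolynomial (Fin n) K))).mapMatrix).symm
  have q4 : ∀ g, ∃ i j, Q g i j ≠ 0 := by
    intro g
    by_contra hcon
    push Not at hcon
    have h0 : Q g = 0 := by ext1 i j; exact hcon i j
    have h5 := hQ g
    rw [h0] at h5
    have h6 : δ • E g = 0 := by rw [← h5]; ext i j; simp
    exact (smul_ne_zero hδ (h4 g)) h6
  have q5 : ∀ g, SymM ct (Q g) := by
    intro g
    apply SymM.of_map (algebraMap (MvPolynomial (Fin n) K) (FractionRing (MvPolynomial (Fin n) K))) hinj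
    rw [hQ]
    exact (hE g).smul δ
  choose i0 j0 hij using q4
  obtain ⟨φ, hφ, hφ0⟩ := exists_line ((D : (MvPolynomial (Fin n) K)) * ∏ g, Q g (i0 g) (j0 g))
    (mul_ne_zero hD0 (Finset.prod_ne_zero_iff.mpr fun g _ => hij g))
  rw [map_mul, map_prod] at hφ
  have hφD : φ D ≠ 0 := left_ne_zero_of_mul hφ
  have hφQ : ∀ g, φ (Q g (i0 g) (j0 g)) ≠ 0 := fun g =>
    Finset.prod_ne_zero_iff.mp (right_ne_zero_of_mul hφ) g (Finset.mem_univ g)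
  obtain ⟨b, u, hu, k, hk⟩ := factor_X (fun _ : Unit => φ D) (fun h => hφD (congrFun h ()))
  have hDu : φ D = PowerSeries.X ^ b * u k := hu k
  obtain ⟨y, hy⟩ : ∃ y, y * u k = 1 := ⟨(u k)⁻¹, PowerSeries.inv_mul_cancel _ hk⟩
  have hyD : y * φ D = PowerSeries.X ^ b := by
    rw [hDu]; linear_combination PowerSeries.X ^ b * hy
  have hy0 : y ≠ 0 := by rintro rfl; simp at hy
  have hsm2 : ∀ M : Matrix (Fin r) (Fin r) (MvPolynomial (Fin n) K),
      φ.mapMatrix ((D : (MvPolynomial (Fin n) K)) • M) = φ D • φ.mapMatrix M := by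
    intro M; ext1 i j; simp
  refine ⟨φ, b, fun g => y • φ.mapMatrix (Q g), hφ0, ?_, ?_, ?_, ?_, ?_⟩
  · intro g
    rw [smul_mul_smul_comm, ← map_mul, q1, hsm2, smul_smul, smul_smul, ← hyD]
    congr 1; ring
  · intro g h hgh
    rw [smul_mul_smul_comm, ← map_mul, q2 g h hgh, map_zero, smul_zero]
  · rw [← Finset.smul_sum, ← map_sum, q3, hsm2, smul_smul, hyD, map_one]
  · intro g h0
    have := congrFun (congrFun h0 (i0 g)) (j0 g)
    exact mul_ne_zero hy0 (hφQ g) this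
  · intro g
    exact ((q5 g).map φ).smul y

end structF


/-- Theorem 4.9. Let `d ≥ 3`, `s ≤ r`, and `h ∈ 𝒮_d = K[x_1,…,x_s]_d`
with no regular splitting of length `≥ 2`. Put
`f = h + x_{s+1}^d/d! + … + x_r^d/d! ∈ ℛ_d`. If `f` is a specialization at `t = 0` of
some `f_t ∈ ℛ_d ⊗_K K[t_1,…,t_n]` that splits regularly `m − 1` times over
`K(t_1,…,t_n)`, and `m > r − s + 1`, then `M_h` contains a nonzero nilpotent matrix `B`
with `(m − r + s)·rank(B) ≤ s`. -/
theorem nilpotent_of_small_rank {K : Type*} [Field K] [CharZero K] {r s d : ℕ}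
    (hd : 3 ≤ d) (hs : s ≤ r)
    (h : MvPolynomial (Fin s) K) (hh : h.IsHomogeneous d)
    (hnosplit : ¬ ∃ G : Set (MvPolynomial (Fin s) K), IsRegSplit d h G ∧ 2 ≤ G.ncard)
    (f : MvPolynomial (Fin r) K)
    (hf : f = MvPolynomial.rename (Fin.castLE hs) h +
      ∑ i ∈ Finset.univ.filter (fun i : Fin r => s ≤ (i : ℕ)),
        (((d.factorial : K))⁻¹ • X i ^ d))
    {n m : ℕ}
    (ft : MvPolynomial (Fin r) (MvPolynomial (Fin n) K)) (hft : ft.IsHomogeneous d)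
    (hft0 : MvPolynomial.map (MvPolynomial.eval (0 : Fin n → K)) ft = f)
    (G : Set (MvPolynomial (Fin r) (FractionRing (MvPolynomial (Fin n) K))))
    (hG : IsRegSplit d (MvPolynomial.map (algebraMap (MvPolynomial (Fin n) K)
      (FractionRing (MvPolynomial (Fin n) K))) ft) G)
    (hGm : G.ncard = m) (hm : r - s + 1 < m) :
    ∃ B : Matrix (Fin s) (Fin s) K, B ∈ Mf h ∧ B ≠ 0 ∧ IsNilpotent B ∧
      (m + s - r) * B.rank ≤ s := by
  classical
  have : Fintype G := hG.1.fintype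
  have hcz : CharZero (FractionRing (MvPolynomial (Fin n) K)) :=
    charZero_of_injective_algebraMap
      (IsFractionRing.injective (MvPolynomial (Fin n) K) (FractionRing (MvPolynomial (Fin n) K)))
  have hmr : m ≤ r := hGm ▸ split_card_le (by omega) hG
  have hcard : Fintype.card G = m := by
    rw [← hGm, ← Nat.card_coe_set_eq, Nat.card_eq_fintype_card]
  by_cases hnd : Nondeg (cc h)
  swap
  · obtain ⟨B, h1, h2, h3, h4⟩ := degenerate_case h (by omega) hnd
    refine ⟨B, h1, h2, h3, ?_⟩
    calc (m + s - r) * B.rank ≤ (m + s - r) * 1 := Nat.mul_le_mul_left _ h4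
      _ ≤ s := by omega
  have hemb : Function.Injective (Fin.castLE hs) := Fin.castLE_injective hs
  have ha := cc_f_emb hs (by omega) h f hf
  have hb := cc_f_out hs h f hf
  have hc0 : ∀ u, dv (cc h) u 0 = 0 := by
    intro u
    unfold dv
    refine Finset.sum_eq_zero fun k _ => ?_
    rw [cc_of_degree_ne hh, mul_zero]
    rw [zero_add, Finsupp.degree_single]
    omega
  have hndf : Nondeg (cc f) := nondeg_f hemb (by omega) ha hb hnd
  have hcf : (fun α => MvPolynomial.eval (0 : Fin n → K) (cc ft α)) = cc f := by
    funext α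
    rw [← hft0, cc_map]
  have hcF : cc (MvPolynomial.map (algebraMap (MvPolynomial (Fin n) K)
      (FractionRing (MvPolynomial (Fin n) K))) ft) = fun α => algebraMap (MvPolynomial (Fin n) K)
      (FractionRing (MvPolynomial (Fin n) K)) (cc ft α) := by
    funext α
    rw [cc_map]
  have hndt := nondeg_generic (cc ft) (by rw [hcf]; exact hndf)
  rw [← hcF] at hndt
  obtain ⟨E, e0, e1, e2, e3, e4⟩ := exists_idem (by omega) hG hndt
  rw [hcF] at e0
  obtain ⟨φ, b, P, hφ, p1, p2, p3, p4, p5⟩ := specialise (cc ft) E e0 e1 e2 e3 e4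
  have hcc : (fun α => PowerSeries.constantCoeff (φ (cc ft α))) = cc f := by
    rw [← hcf]
    funext α
    exact hφ _
  obtain ⟨N, n1, n2, n3, n4⟩ := main_ps P b p1 p2 p3 p4 (fun α => φ (cc ft α)) p5
    (Fin.castLE hs) hemb (by
      rw [hcc]
      intro e he hee
      obtain ⟨s1, s2, s3⟩ := sym_struct hemb hd ha hb hnd hc0 he
      exact idem_trivial (by omega) hh hnd hnosplit s3
        (by rw [submatrix_mul_self hemb s1, hee])) hs (by rw [hcard]; exact hm)
  rw [hcc] at n1
  rw [hcard] at n4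
  obtain ⟨s1, s2, s3⟩ := sym_struct hemb hd ha hb hnd hc0 n1
  refine ⟨N.submatrix (Fin.castLE hs) (Fin.castLE hs), (mem_Mf_iff _ _).mpr s3,
    submatrix_ne_zero s1 s2 n2 n3, ⟨2, ?_⟩, ?_⟩
  · rw [sq, submatrix_mul_self hemb s1, n3]
    rfl
  · exact (Nat.mul_le_mul_left _ (Matrix.rank_submatrix_le _ _ _)).trans n4

end Kleppe
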